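/- If the Coxeter group W is infinite, the dual space (RΛ)*_R decomposes as a disjoint union of the interior of the Tits cone, the set of functionals vanishing on some nonzero element of the closed imaginary cone, and the negative of the interior of the Tits cone: (RΛ)*_R = T_R° ⊔ U ⊔ (-T_R°), where U = {Z : Z(v) = 0 for some v ∈ I \ {0}}. -/

import Mathlib

noncomputable def coxEntry {B : Type*} (M : CoxeterMatrix B) (s t : B) : ℝ :=
  if M s t = 0 then -2 else -2 * Real.cos (Real.pi / (M s t))

noncomputable def coxForm {B : Type*} [Fintype B] (M : CoxeterMatrix B) (v w : B → ℝ) : ℝ :=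
  ∑ s, ∑ t, v s * w t * coxEntry M s t

/-- The simple root `α_s` in `RΛ ≅ (B → ℝ)`. -/
noncomputable def simpleRoot {B : Type*} [DecidableEq B] (s : B) : B → ℝ := Pi.single s 1

/-- The set of real roots: the `W`-orbit of the simple roots under the Tits representation. -/
def rootSet {B : Type*} [DecidableEq B] {W : Type*} [Group W]
    (ρ : W →* ((B → ℝ) ≃ₗ[ℝ] (B → ℝ))) : Set (B → ℝ) :=
  {v | ∃ (w : W) (s : B), v = ρ w (simpleRoot s)}

/-- The set of positive real roots. -/
def posRootSet {B : Type*} [DecidableEq B] {W : Type*} [Group W]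
    (ρ : W →* ((B → ℝ) ≃ₗ[ℝ] (B → ℝ))) : Set (B → ℝ) :=
  {v ∈ rootSet ρ | ∀ i, 0 ≤ v i}

/-- The set `K = {v ∈ ℝ_{≥0}Λ : B(v, α_s) ≤ 0 for all s}`. -/
noncomputable def coneK {B : Type*} [Fintype B] [DecidableEq B] (M : CoxeterMatrix B) :
    Set (B → ℝ) :=
  {v | (∀ i, 0 ≤ v i) ∧ ∀ s, coxForm M v (simpleRoot s) ≤ 0}

/-- The closed imaginary cone `I = closure (W · K)`. -/
noncomputable def imagCone {B : Type*} [Fintype B] [DecidableEq B] (M : CoxeterMatrix B)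
    {W : Type*} [Group W] (ρ : W →* ((B → ℝ) ≃ₗ[ℝ] (B → ℝ))) : Set (B → ℝ) :=
  closure {v | ∃ (w : W), ∃ k ∈ coneK M, v = ρ w k}


/-- The pairing between the dual space `(RΛ)*` (in coordinates: `z : B → ℝ`, with
`z i = Z(α_i)`) and `RΛ`. -/
def evalR {B : Type*} [Fintype B] (z : B → ℝ) (v : B → ℝ) : ℝ := ∑ i, v i * z i

/-- The Tits cone `T = W · C̄` in the dual space, written in coordinates. -/
def titsConeCoord {B : Type*} [Fintype B] [DecidableEq B] {W : Type*} [Group W]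
    (ρ : W →* ((B → ℝ) ≃ₗ[ℝ] (B → ℝ))) : Set (B → ℝ) :=
  {z | ∃ w : W, ∀ s : B, 0 ≤ evalR z (ρ w (simpleRoot s))}

section CoxAux

set_option linter.unusedSectionVars false

open CoxeterSystem

variable {B : Type*} [Fintype B] [DecidableEq B] {M : CoxeterMatrix B}

lemma coxEntry_symm (M : CoxeterMatrix B) (s t : B) : coxEntry M s t = coxEntry M t s := by
  unfold coxEntry; rw [M.symmetric s t]

lemma coxEntry_self (M : CoxeterMatrix B) (s : B) : coxEntry M s s = 2 := by
  unfold coxEntry; simp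

lemma coxEntry_nonpos (M : CoxeterMatrix B) {s t : B} (h : s ≠ t) : coxEntry M s t ≤ 0 := by
  unfold coxEntry
  split_ifs with h0
  · norm_num
  · have h1 := M.off_diagonal s t h
    have h2 : (2 : ℝ) ≤ (M s t : ℝ) := by
      have : 2 ≤ M s t := by omega
      exact_mod_cast this
    have h3 : 0 ≤ Real.cos (Real.pi / (M s t)) := by
      apply Real.cos_nonneg_of_neg_pi_div_two_le_of_le
      · have : 0 ≤ Real.pi / (M s t) := by positivity
        linarith [Real.pi_pos]
      · apply div_le_div_of_nonneg_left Real.pi_pos.le (by norm_num) h2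
    linarith

lemma coxForm_add_left (v v' w : B → ℝ) :
    coxForm M (v + v') w = coxForm M v w + coxForm M v' w := by
  simp [coxForm, add_mul, Finset.sum_add_distrib]

lemma coxForm_smul_left (c : ℝ) (v w : B → ℝ) :
    coxForm M (c • v) w = c * coxForm M v w := by
  simp [coxForm, Finset.mul_sum, mul_assoc]

lemma coxForm_symm (v w : B → ℝ) : coxForm M v w = coxForm M w v := by
  unfold coxForm
  rw [Finset.sum_comm]
  refine Finset.sum_congr rfl fun s _ => Finset.sum_congr rfl fun t _ => ?_
  rw [coxEntry_symm M t s]; ring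

lemma coxForm_add_right (v w w' : B → ℝ) :
    coxForm M v (w + w') = coxForm M v w + coxForm M v w' := by
  simp [coxForm_symm (M := M) v, coxForm_add_left]

lemma coxForm_smul_right (c : ℝ) (v w : B → ℝ) :
    coxForm M v (c • w) = c * coxForm M v w := by
  simp [coxForm_symm (M := M) v, coxForm_smul_left]

lemma coxForm_neg_left (v w : B → ℝ) : coxForm M (-v) w = - coxForm M v w := by
  have := coxForm_smul_left (M := M) (-1) v w
  simpa using this

lemma coxForm_sub_left (v v' w : B → ℝ) :
    coxForm M (v - v') w = coxForm M v w - coxForm M v' w := by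
  rw [sub_eq_add_neg, coxForm_add_left, coxForm_neg_left]; ring

lemma coxForm_sub_right (v w w' : B → ℝ) :
    coxForm M v (w - w') = coxForm M v w - coxForm M v w' := by
  simp [coxForm_symm (M := M) v, coxForm_sub_left]

lemma coxForm_simple_right (v : B → ℝ) (s : B) :
    coxForm M v (simpleRoot s) = ∑ t, v t * coxEntry M t s := by
  unfold coxForm simpleRoot
  refine Finset.sum_congr rfl fun t _ => ?_
  rw [Finset.sum_eq_single s]
  · simp
  · intro b _ hb; simp [hb]
  · simp

lemma coxForm_simple_simple (s t : B) :
    coxForm M (simpleRoot s) (simpleRoot t) = coxEntry M s t := by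
  rw [coxForm_simple_right, Finset.sum_eq_single s]
  · simp [simpleRoot]
  · intro b _ hb; simp [simpleRoot, hb]
  · simp

lemma coxForm_eq_sum (v w : B → ℝ) :
    coxForm M v w = ∑ s, w s * coxForm M v (simpleRoot s) := by
  simp_rw [coxForm_simple_right, Finset.mul_sum]
  unfold coxForm
  rw [Finset.sum_comm]
  refine Finset.sum_congr rfl fun s _ => Finset.sum_congr rfl fun t _ => ?_
  ring

lemma continuous_coxForm : Continuous fun p : (B → ℝ) × (B → ℝ) => coxForm M p.1 p.2 := by
  unfold coxForm; fun_prop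

lemma Continuous.coxForm' {X : Type*} [TopologicalSpace X] {f g : X → (B → ℝ)}
    (hf : Continuous f) (hg : Continuous g) : Continuous fun x => coxForm M (f x) (g x) :=
  continuous_coxForm.comp (hf.prodMk hg)

lemma eq_sum_simpleRoot (v : B → ℝ) : v = ∑ s, v s • simpleRoot s := by
  ext i
  simp [simpleRoot, Pi.single_apply]

lemma cheb_exists (M : CoxeterMatrix B) {s t : B} (h : s ≠ t) :
    ∃ u : ℕ → ℝ, u 0 = 0 ∧ u 1 = 1 ∧ (∀ k, u (k + 2) = - coxEntry M s t * u (k + 1) - u k) ∧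
      ∀ k, (M s t = 0 ∨ k ≤ M s t) → 0 ≤ u k := by
  by_cases h0 : M s t = 0
  · refine ⟨fun k => k, by simp, by simp, ?_, ?_⟩
    · intro k; simp [coxEntry, h0]; ring
    · intro k _; positivity
  · have h1 := M.off_diagonal s t h
    have h2 : (2 : ℝ) ≤ (M s t : ℝ) := by
      have : 2 ≤ M s t := by omega
      exact_mod_cast this
    set θ := Real.pi / (M s t) with hθ
    have hθ0 : 0 < θ := by positivity
    have hθ1 : θ < Real.pi := by
      rw [hθ, div_lt_iff₀ (by positivity)]
      nlinarith [Real.pi_pos]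
    have hs : 0 < Real.sin θ := Real.sin_pos_of_pos_of_lt_pi hθ0 hθ1
    refine ⟨fun k => Real.sin (k * θ) / Real.sin θ, by simp, by simp [hs.ne'], ?_, ?_⟩
    · intro k
      simp only [coxEntry, h0, if_false, ← hθ]
      rw [show ((k + 2 : ℕ) : ℝ) * θ = (k + 1 : ℕ) * θ + θ by push_cast; ring,
        show ((k : ℕ) : ℝ) * θ = (k + 1 : ℕ) * θ - θ by push_cast; ring,
        Real.sin_add, Real.sin_sub]
      ring
    · intro k hk
      have hk : k ≤ M s t := hk.resolve_left h0
      apply div_nonneg _ hs.le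
      apply Real.sin_nonneg_of_nonneg_of_le_pi (by positivity)
      have : (k : ℝ) ≤ M s t := by exact_mod_cast hk
      rw [hθ, mul_div_assoc', div_le_iff₀ (by positivity)]
      nlinarith [Real.pi_pos]

variable {W : Type*} [Group W] (cs : CoxeterSystem M W)
    (ρ : W →* ((B → ℝ) ≃ₗ[ℝ] (B → ℝ)))

/-- `ρ` is the Tits representation. -/
def IsTits : Prop := ∀ (s : B) (v : B → ℝ),
      ρ (cs.simple s) v = v - coxForm M (simpleRoot s) v • simpleRoot s

variable {cs ρ}

lemma rho_mul_apply (ρ : W →* ((B → ℝ) ≃ₗ[ℝ] (B → ℝ))) (w w' : W) (v : B → ℝ) :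
    ρ (w * w') v = ρ w (ρ w' v) := by
  rw [map_mul]; rfl

lemma rho_inv_apply (ρ : W →* ((B → ℝ) ≃ₗ[ℝ] (B → ℝ))) (w : W) (v : B → ℝ) :
    ρ w⁻¹ (ρ w v) = v := by
  rw [← rho_mul_apply]; simp

lemma rho_apply_inv (ρ : W →* ((B → ℝ) ≃ₗ[ℝ] (B → ℝ))) (w : W) (v : B → ℝ) :
    ρ w (ρ w⁻¹ v) = v := by
  rw [← rho_mul_apply]; simp

lemma IsTits.simple_simple (hρ : IsTits cs ρ) (s t : B) :
    ρ (cs.simple s) (simpleRoot t) = simpleRoot t - coxEntry M s t • simpleRoot s := by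
  rw [hρ, coxForm_simple_simple]

lemma IsTits.simple_self (hρ : IsTits cs ρ) (s : B) :
    ρ (cs.simple s) (simpleRoot s) = - simpleRoot s := by
  rw [hρ.simple_simple, coxEntry_self, two_smul]; abel

lemma IsTits.form_inv (hρ : IsTits cs ρ) (w : W) : ∀ (v v' : B → ℝ),
    coxForm M (ρ w v) (ρ w v') = coxForm M v v' := by
  induction w using cs.simple_induction_left with
  | one => simp
  | mul_simple_left w s ih =>
    intro v v'
    rw [rho_mul_apply, rho_mul_apply, hρ, hρ, coxForm_sub_left, coxForm_sub_right,
      coxForm_sub_right, coxForm_smul_left, coxForm_smul_right, coxForm_smul_left,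
      coxForm_smul_right, ih, coxForm_simple_simple, coxEntry_self,
      coxForm_symm (ρ w v) (simpleRoot s)]
    ring

lemma IsTits.alt (hρ : IsTits cs ρ) {s t : B} {u : ℕ → ℝ} (h0 : u 0 = 0) (h1 : u 1 = 1)
    (hu : ∀ k, u (k + 2) = - coxEntry M s t * u (k + 1) - u k) (k : ℕ) :
    ρ (cs.wordProd (alternatingWord s t k)) (simpleRoot s) =
      if Even k then u (k + 1) • simpleRoot s + u k • simpleRoot t
      else u k • simpleRoot s + u (k + 1) • simpleRoot t := by
  induction k with
  | zero => simp [alternatingWord, h0, h1]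
  | succ k ih =>
    rw [alternatingWord_succ', wordProd_cons, rho_mul_apply, ih]
    by_cases hk : Even k
    · have hk' : ¬ Even (k + 1) := by simpa [Nat.even_add_one] using hk
      simp only [hk, hk', if_true, if_false, map_add, map_smul, hρ.simple_self,
        hρ.simple_simple, hu, coxEntry_symm M t s]
      module
    · have hk' : Even (k + 1) := by simpa [Nat.even_add_one] using hk
      simp only [hk, hk', if_true, if_false, map_add, map_smul, hρ.simple_self,
        hρ.simple_simple, hu]
      module

lemma simpleRoot_nonneg (s : B) : 0 ≤ simpleRoot s := by
  intro i; simp only [simpleRoot, Pi.single_apply]; split_ifs <;> simp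

lemma IsTits.pos_aux (hρ : IsTits cs ρ) (n : ℕ) : ∀ (w : W) (s : B), cs.length w = n →
    cs.length w < cs.length (w * cs.simple s) → 0 ≤ ρ w (simpleRoot s) := by
  induction n using Nat.strong_induction_on with
  | _ n ih =>
    intro w s hn hs
    by_cases hw : w = 1
    · subst hw; simpa using simpleRoot_nonneg s
    obtain ⟨t, ht⟩ := cs.exists_rightDescent_of_ne_one hw
    unfold IsRightDescent at ht
    have hst : s ≠ t := by rintro rfl; omega
    let P : ℕ → Prop := fun k => ∃ v, w = v * cs.wordProd (alternatingWord s t k) ∧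
      cs.length w = cs.length v + k
    classical
    have hP1 : P 1 := by
      refine ⟨w * cs.simple t, by simp [alternatingWord], ?_⟩
      have := cs.length_mul_simple w t
      omega
    have hPb : ∀ k, P k → k ≤ n := by
      rintro k ⟨v, -, hv⟩; omega
    set k := Nat.findGreatest P n with hk
    have hPk : P k := Nat.findGreatest_spec (hPb 1 hP1) hP1
    have hk1 : 1 ≤ k := Nat.le_findGreatest (hPb 1 hP1) hP1
    have hkmax : ¬ P (k + 1) := by
      intro h
      have := Nat.le_findGreatest (hPb _ h) h
      omega
    obtain ⟨v, hwv, hlen⟩ := hPk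
    -- the next letter
    have key : ∀ r, (r = if Even k then t else s) → cs.length v < cs.length (v * cs.simple r) := by
      intro r hr
      by_contra hlt
      have := cs.length_mul_simple v r
      apply hkmax
      refine ⟨v * cs.simple r, ?_, by omega⟩
      rw [alternatingWord_succ', wordProd_cons, ← hr, mul_assoc, simple_mul_simple_cancel_left]
      exact hwv
    have key' : ∀ r, (r = if Even k then s else t) → cs.length v < cs.length (v * cs.simple r) := by
      intro r hr
      obtain ⟨j, hj⟩ : ∃ j, k = j + 1 := ⟨k - 1, by omega⟩
      have hr' : r = if Even j then t else s := by
        rw [hr, hj]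
        by_cases h : Even j
        · simp [Nat.even_add_one, h]
        · simp [Nat.even_add_one, h]
      have e : w = v * cs.simple r * cs.wordProd (alternatingWord s t j) := by
        conv_lhs => rw [hwv, hj, alternatingWord_succ', wordProd_cons, ← hr', ← mul_assoc]
      have h1 := cs.length_mul_le (v * cs.simple r) (cs.wordProd (alternatingWord s t j))
      have h2 := cs.length_wordProd_le (alternatingWord s t j)
      rw [length_alternatingWord] at h2
      rw [← e] at h1
      omega
    have hvs : 0 ≤ ρ v (simpleRoot s) := by
      apply ih (cs.length v) (by omega) v s rfl
      by_cases h : Even k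
      · exact key' s (by simp [h])
      · exact key s (by simp [h])
    have hvt : 0 ≤ ρ v (simpleRoot t) := by
      apply ih (cs.length v) (by omega) v t rfl
      by_cases h : Even k
      · exact key t (by simp [h])
      · exact key' t (by simp [h])
    have hkm : M s t = 0 ∨ k + 1 ≤ M s t := by
      by_contra! hc
      have h1 := cs.not_isReduced_alternatingWord t s (m := k + 1)
        (by rw [M.symmetric]; exact hc.1) (by rw [M.symmetric]; exact hc.2)
      unfold CoxeterSystem.IsReduced at h1
      have h2 := cs.length_wordProd_le (alternatingWord t s (k + 1))
      rw [length_alternatingWord] at h1 h2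
      have e : w * cs.simple s = v * cs.wordProd (alternatingWord t s (k + 1)) := by
        rw [alternatingWord_succ, wordProd_concat, ← mul_assoc, ← hwv]
      have h3 := cs.length_mul_le v (cs.wordProd (alternatingWord t s (k + 1)))
      rw [← e] at h3
      omega
    obtain ⟨u, hu0, hu1, hu, hupos⟩ := cheb_exists M hst
    have huk : 0 ≤ u k := hupos k (by omega)
    have huk1 : 0 ≤ u (k + 1) := hupos (k + 1) hkm
    rw [hwv, rho_mul_apply, hρ.alt hu0 hu1 hu k]
    split_ifs
    · rw [map_add, map_smul, map_smul]
      exact add_nonneg (smul_nonneg huk1 hvs) (smul_nonneg huk hvt)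
    · rw [map_add, map_smul, map_smul]
      exact add_nonneg (smul_nonneg huk hvs) (smul_nonneg huk1 hvt)

lemma IsTits.pos (hρ : IsTits cs ρ) {w : W} {s : B}
    (h : cs.length w < cs.length (w * cs.simple s)) : 0 ≤ ρ w (simpleRoot s) :=
  hρ.pos_aux _ w s rfl h

lemma IsTits.neg (hρ : IsTits cs ρ) {w : W} {s : B}
    (h : cs.length (w * cs.simple s) < cs.length w) : ρ w (simpleRoot s) ≤ 0 := by
  have h1 : 0 ≤ ρ (w * cs.simple s) (simpleRoot s) := hρ.pos (by simpa using h)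
  rw [rho_mul_apply, hρ.simple_self, map_neg] at h1
  simpa using h1

lemma IsTits.pos_or_neg (hρ : IsTits cs ρ) (w : W) (s : B) :
    0 ≤ ρ w (simpleRoot s) ∨ ρ w (simpleRoot s) ≤ 0 := by
  rcases cs.length_mul_simple w s with h | h
  · exact .inl (hρ.pos (by omega))
  · exact .inr (hρ.neg (by omega))

lemma IsTits.eq_one (hρ : IsTits cs ρ) {w : W}
    (h : ∀ s, 0 < (ρ w (simpleRoot s)) s) : w = 1 := by
  by_contra hw
  obtain ⟨t, ht⟩ := cs.exists_rightDescent_of_ne_one hw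
  have := hρ.neg ht t
  have := h t
  simp only [Pi.zero_apply] at *
  linarith

lemma evalR_add (z v v' : B → ℝ) : evalR z (v + v') = evalR z v + evalR z v' := by
  simp [evalR, add_mul, Finset.sum_add_distrib]

lemma evalR_smul (z : B → ℝ) (c : ℝ) (v : B → ℝ) : evalR z (c • v) = c * evalR z v := by
  simp [evalR, Finset.mul_sum, mul_assoc]

lemma evalR_add_left (z z' v : B → ℝ) : evalR (z + z') v = evalR z v + evalR z' v := by
  simp [evalR, mul_add, Finset.sum_add_distrib]

lemma evalR_smul_left (z : B → ℝ) (c : ℝ) (v : B → ℝ) : evalR (c • z) v = c * evalR z v := by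
  simp only [evalR, Finset.mul_sum, Pi.smul_apply, smul_eq_mul]
  exact Finset.sum_congr rfl fun i _ => by ring

lemma evalR_neg_left (z v : B → ℝ) : evalR (-z) v = - evalR z v := by
  have := evalR_smul_left z (-1) v
  simpa using this

lemma continuous_evalR : Continuous fun p : (B → ℝ) × (B → ℝ) => evalR p.1 p.2 := by
  unfold evalR; fun_prop

lemma evalR_nonneg {z v : B → ℝ} (hz : 0 ≤ z) (hv : 0 ≤ v) : 0 ≤ evalR z v :=
  Finset.sum_nonneg fun i _ => mul_nonneg (hv i) (hz i)

lemma evalR_simpleRoot (z : B → ℝ) (s : B) : evalR z (simpleRoot s) = z s := by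
  simp [evalR, simpleRoot, Pi.single_apply]

/-- The transported functional `Z ∘ w`. -/
noncomputable def pull (ρ : W →* ((B → ℝ) ≃ₗ[ℝ] (B → ℝ))) (z : B → ℝ) (w : W) : B → ℝ :=
  fun s => evalR z (ρ w (simpleRoot s))

lemma evalR_sum {ι : Type*} (z : B → ℝ) (S : Finset ι) (f : ι → (B → ℝ)) :
    evalR z (∑ i ∈ S, f i) = ∑ i ∈ S, evalR z (f i) := by
  classical
  induction S using Finset.induction_on with
  | empty => simp [evalR]
  | insert a S ha ih => rw [Finset.sum_insert ha, Finset.sum_insert ha, evalR_add, ih]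

lemma evalR_pull (z : B → ℝ) (w : W) (v : B → ℝ) :
    evalR (pull ρ z w) v = evalR z (ρ w v) := by
  conv_rhs => rw [eq_sum_simpleRoot v]
  simp only [map_sum, map_smul, evalR_sum, evalR_smul]
  rfl

lemma IsTits.root_form (hρ : IsTits cs ρ) {β : B → ℝ} (h : β ∈ rootSet ρ) :
    coxForm M β β = 2 := by
  obtain ⟨w, s, rfl⟩ := h
  rw [hρ.form_inv, coxForm_simple_simple, coxEntry_self]

lemma IsTits.root_pos_or_neg (hρ : IsTits cs ρ) {β : B → ℝ} (h : β ∈ rootSet ρ) :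
    0 ≤ β ∨ β ≤ 0 := by
  obtain ⟨w, s, rfl⟩ := h
  exact hρ.pos_or_neg w s

lemma rootSet_map {β : B → ℝ} (h : β ∈ rootSet ρ) (w : W) : ρ w β ∈ rootSet ρ := by
  obtain ⟨w', s, rfl⟩ := h
  exact ⟨w * w', s, by rw [rho_mul_apply]⟩

lemma IsTits.refl (hρ : IsTits cs ρ) {β : B → ℝ} (h : β ∈ rootSet ρ) :
    ∃ w : W, ∀ x, ρ w x = x - coxForm M β x • β := by
  obtain ⟨w, s, rfl⟩ := h
  refine ⟨w * cs.simple s * w⁻¹, fun x => ?_⟩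
  rw [rho_mul_apply, rho_mul_apply, hρ, map_sub, map_smul, rho_apply_inv]
  congr 2
  rw [← hρ.form_inv w, rho_apply_inv]

lemma simpleRoot_mem_pos (s : B) : simpleRoot s ∈ posRootSet ρ :=
  ⟨⟨1, s, by simp⟩, simpleRoot_nonneg s⟩

lemma IsTits.root_ne_zero (hρ : IsTits cs ρ) {β : B → ℝ} (h : β ∈ rootSet ρ) : β ≠ 0 := by
  rintro rfl
  have := hρ.root_form h
  simp [coxForm] at this

lemma IsTits.proportional (hρ : IsTits cs ρ) {β β' : B → ℝ} (h : β ∈ posRootSet ρ)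
    (h' : β' ∈ posRootSet ρ) {c : ℝ} (hc : β = c • β') : β = β' := by
  have h1 := hρ.root_form h.1
  rw [hc, coxForm_smul_left, coxForm_smul_right, hρ.root_form h'.1] at h1
  have h2 : (c - 1) * (c + 1) = 0 := by linarith
  rcases mul_eq_zero.1 h2 with h2 | h2
  · rw [hc, show c = 1 by linarith, one_smul]
  · exfalso
    have hc' : c = -1 := by linarith
    apply hρ.root_ne_zero h.1
    ext i
    have a := h.2 i
    have b := h'.2 i
    rw [hc, hc'] at a ⊢
    simp at a ⊢
    linarith

lemma IsTits.simple_pos (hρ : IsTits cs ρ) {β : B → ℝ} (h : β ∈ posRootSet ρ) {s : B}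
    (hs : β ≠ simpleRoot s) : ρ (cs.simple s) β ∈ posRootSet ρ := by
  have hr := rootSet_map h.1 (cs.simple s)
  refine ⟨hr, ?_⟩
  rcases hρ.root_pos_or_neg hr with h1 | h1
  · exact h1
  · exfalso
    apply hs
    refine hρ.proportional h (simpleRoot_mem_pos s) (c := β s) ?_
    ext t
    by_cases ht : t = s
    · subst ht; simp [simpleRoot]
    · have h2 := h1 t
      rw [hρ] at h2
      have h3 := h.2 t
      simp [simpleRoot, ht] at h2 ⊢
      linarith

lemma IsTits.inv_finite (hρ : IsTits cs ρ) (w : W) :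
    {β ∈ posRootSet ρ | ρ w β ∉ posRootSet ρ}.Finite := by
  induction w using cs.simple_induction_left with
  | one =>
    convert Set.finite_empty
    ext β; simp
  | mul_simple_left w s ih =>
    have h2 : {β | ρ w β = simpleRoot s}.Finite :=
      Set.Subsingleton.finite fun a ha b hb => (ρ w).injective (ha.trans hb.symm)
    refine (ih.union h2).subset ?_
    rintro β ⟨hβ, hn⟩
    by_contra hc
    simp only [Set.mem_union, Set.mem_ofPred_eq, not_or, not_and, not_not] at hc
    apply hn
    rw [rho_mul_apply]
    exact hρ.simple_pos (hc.1 hβ) hc.2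

lemma IsTits.finite_of_mem (hρ : IsTits cs ρ) {z : B → ℝ} (hz : z ∈ titsConeCoord ρ) :
    {β ∈ posRootSet ρ | evalR z β < 0}.Finite := by
  obtain ⟨w, hw⟩ := hz
  refine (hρ.inv_finite w⁻¹).subset ?_
  rintro β ⟨hβ, hn⟩
  refine ⟨hβ, fun hc => ?_⟩
  have h1 : 0 ≤ evalR (pull ρ z w) (ρ w⁻¹ β) := evalR_nonneg hw hc.2
  rw [evalR_pull, rho_apply_inv] at h1
  linarith

lemma IsTits.mem_aux (hρ : IsTits cs ρ) (n : ℕ) : ∀ z : B → ℝ,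
    {β ∈ posRootSet ρ | evalR z β < 0}.Finite →
    {β ∈ posRootSet ρ | evalR z β < 0}.ncard = n → z ∈ titsConeCoord ρ := by
  induction n using Nat.strong_induction_on with
  | _ n ih =>
    intro z hf hn
    by_cases hz : ∀ s, 0 ≤ z s
    · exact ⟨1, fun s => by simpa [evalR_simpleRoot] using hz s⟩
    push Not at hz
    obtain ⟨s, hs⟩ := hz
    set N := {β ∈ posRootSet ρ | evalR z β < 0} with hN
    set N' := {β ∈ posRootSet ρ | evalR (pull ρ z (cs.simple s)) β < 0} with hN'
    have hsN : simpleRoot s ∈ N := ⟨simpleRoot_mem_pos s, by rwa [evalR_simpleRoot]⟩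
    have hinv : ∀ x, ρ (cs.simple s) (ρ (cs.simple s) x) = x := by
      intro x; rw [← rho_mul_apply]; simp
    have hsub : N' ⊆ ρ (cs.simple s) '' (N \ {simpleRoot s}) := by
      rintro β ⟨hβ, hb⟩
      rw [evalR_pull] at hb
      have hne : β ≠ simpleRoot s := by
        rintro rfl
        rw [hρ.simple_self, ← neg_one_smul ℝ, evalR_smul, evalR_simpleRoot] at hb
        linarith
      refine ⟨ρ (cs.simple s) β, ⟨⟨hρ.simple_pos hβ hne, hb⟩, ?_⟩, hinv β⟩
      intro hc
      have hc : ρ (cs.simple s) β = simpleRoot s := hc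
      have h1 := hinv β
      rw [hc, hρ.simple_self] at h1
      have h2 := hβ.2 s
      rw [← h1] at h2
      simp [simpleRoot] at h2
      linarith
    have hfin : (N \ {simpleRoot s}).Finite := hf.subset Set.sdiff_subset
    have hf' : N'.Finite := (hfin.image _).subset hsub
    have hcard : N'.ncard < n := by
      calc N'.ncard ≤ (ρ (cs.simple s) '' (N \ {simpleRoot s})).ncard :=
            Set.ncard_le_ncard hsub (hfin.image _)
        _ ≤ (N \ {simpleRoot s}).ncard := Set.ncard_image_le hfin
        _ < N.ncard := Set.ncard_sdiff_singleton_lt_of_mem hsN hf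
        _ = n := hn
    obtain ⟨w, hw⟩ := ih _ hcard _ hf' rfl
    refine ⟨cs.simple s * w, fun t => ?_⟩
    rw [rho_mul_apply, ← evalR_pull]
    exact hw t

lemma IsTits.mem_iff (hρ : IsTits cs ρ) {z : B → ℝ} :
    z ∈ titsConeCoord ρ ↔ {β ∈ posRootSet ρ | evalR z β < 0}.Finite :=
  ⟨hρ.finite_of_mem, fun h => hρ.mem_aux _ z h rfl⟩

lemma IsTits.tits_add (hρ : IsTits cs ρ) {z z' : B → ℝ} (h : z ∈ titsConeCoord ρ)
    (h' : z' ∈ titsConeCoord ρ) : z + z' ∈ titsConeCoord ρ := by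
  rw [hρ.mem_iff] at *
  refine (h.union h').subset ?_
  rintro β ⟨hβ, hb⟩
  rw [evalR_add_left] at hb
  by_contra hc
  simp only [Set.mem_union, Set.mem_ofPred_eq, not_or, not_and, not_lt] at hc
  linarith [hc.1 hβ, hc.2 hβ]

lemma IsTits.coneK_le (hρ : IsTits cs ρ) {k : B → ℝ} (hk : k ∈ coneK M) (n : ℕ) :
    ∀ w : W, cs.length w = n → 0 ≤ ρ w k := by
  induction n with
  | zero =>
    intro w hw
    rw [cs.length_eq_zero_iff] at hw
    subst hw
    rw [map_one]
    exact hk.1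
  | succ n ih =>
    intro w hw
    have hw1 : w ≠ 1 := by rintro rfl; simp at hw
    obtain ⟨t, ht⟩ := cs.exists_rightDescent_of_ne_one hw1
    rw [cs.isRightDescent_iff] at ht
    have e : w = (w * cs.simple t) * cs.simple t := by simp
    have h1 := ih (w * cs.simple t) (by omega)
    have h2 : 0 ≤ ρ (w * cs.simple t) (simpleRoot t) := hρ.pos (by simp; omega)
    rw [e, rho_mul_apply, hρ, map_sub, map_smul, sub_eq_add_neg, ← neg_smul]
    refine add_nonneg h1 (smul_nonneg ?_ h2)
    have := hk.2 t
    rw [coxForm_symm] at this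
    linarith

/-- The imaginary cone. -/
def imag0 (M : CoxeterMatrix B) (ρ : W →* ((B → ℝ) ≃ₗ[ℝ] (B → ℝ))) : Set (B → ℝ) :=
  {v | ∃ (w : W), ∃ k ∈ coneK M, v = ρ w k}

lemma IsTits.imag0_iff (hρ : IsTits cs ρ) {v : B → ℝ} :
    v ∈ imag0 M ρ ↔ (∀ w, 0 ≤ ρ w v) ∧
      (fun s => - coxForm M v (simpleRoot s)) ∈ titsConeCoord ρ := by
  have hev : ∀ x, evalR (fun s => - coxForm M v (simpleRoot s)) x = - coxForm M v x := by
    intro x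
    rw [coxForm_eq_sum, evalR, ← Finset.sum_neg_distrib]
    exact Finset.sum_congr rfl fun i _ => by ring
  constructor
  · rintro ⟨w, k, hk, rfl⟩
    constructor
    · intro w'
      rw [← rho_mul_apply]
      exact hρ.coneK_le hk _ _ rfl
    · refine ⟨w, fun s => ?_⟩
      rw [hev, hρ.form_inv]
      linarith [hk.2 s]
  · rintro ⟨h1, w, h2⟩
    refine ⟨w, ρ w⁻¹ v, ⟨h1 w⁻¹, fun s => ?_⟩, by rw [rho_apply_inv]⟩
    have := h2 s
    rw [hev] at this
    rw [← hρ.form_inv w, rho_apply_inv]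
    linarith

lemma IsTits.imag0_add (hρ : IsTits cs ρ) {v v' : B → ℝ} (h : v ∈ imag0 M ρ)
    (h' : v' ∈ imag0 M ρ) : v + v' ∈ imag0 M ρ := by
  rw [hρ.imag0_iff] at *
  constructor
  · intro w; rw [map_add]; exact add_nonneg (h.1 w) (h'.1 w)
  · convert hρ.tits_add h.2 h'.2 using 1
    ext s
    simp [coxForm_add_left]; ring

lemma imag0_smul {v : B → ℝ} (h : v ∈ imag0 M ρ) {c : ℝ} (hc : 0 ≤ c) :
    c • v ∈ imag0 M ρ := by
  obtain ⟨w, k, hk, rfl⟩ := h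
  refine ⟨w, c • k, ⟨fun i => mul_nonneg hc (hk.1 i), fun s => ?_⟩, by rw [map_smul]⟩
  rw [coxForm_smul_left]
  exact mul_nonpos_of_nonneg_of_nonpos hc (hk.2 s)

lemma imagCone_eq : imagCone M ρ = closure (imag0 M ρ) := rfl

lemma IsTits.imagCone_add (hρ : IsTits cs ρ) {v v' : B → ℝ} (h : v ∈ imagCone M ρ)
    (h' : v' ∈ imagCone M ρ) : v + v' ∈ imagCone M ρ := by
  rw [imagCone_eq] at *
  exact map_mem_closure₂ continuous_add h h' fun a ha b hb => hρ.imag0_add ha hb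

lemma imagCone_smul {v : B → ℝ} (h : v ∈ imagCone M ρ) {c : ℝ} (hc : 0 ≤ c) :
    c • v ∈ imagCone M ρ := by
  rw [imagCone_eq] at *
  exact map_mem_closure (continuous_const_smul c) h fun a ha => imag0_smul ha hc

lemma IsTits.imagCone_nonneg (hρ : IsTits cs ρ) {v : B → ℝ} (h : v ∈ imagCone M ρ) (w : W) :
    0 ≤ ρ w v := by
  rw [imagCone_eq] at h
  have hc : Continuous (ρ w) := (ρ w).toLinearMap.continuous_of_finiteDimensional
  have hcl : IsClosed {v : B → ℝ | 0 ≤ ρ w v} := isClosed_le continuous_const hc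
  exact closure_minimal (fun x hx => (hρ.imag0_iff.1 hx).1 w) hcl h

lemma IsTits.tits_imag_nonneg (hρ : IsTits cs ρ) {v z : B → ℝ} (h : v ∈ imagCone M ρ)
    (hz : z ∈ titsConeCoord ρ) : 0 ≤ evalR z v := by
  obtain ⟨w, hw⟩ := hz
  have h1 : 0 ≤ evalR (pull ρ z w) (ρ w⁻¹ v) := evalR_nonneg hw (hρ.imagCone_nonneg h _)
  rwa [evalR_pull, rho_apply_inv] at h1

lemma IsTits.interior_imag_pos (hρ : IsTits cs ρ) {v z : B → ℝ} (h : v ∈ imagCone M ρ)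
    (hv : v ≠ 0) (hz : z ∈ interior (titsConeCoord ρ)) : 0 < evalR z v := by
  have hc : Continuous fun t : ℝ => z - t • v := by fun_prop
  have h0 : ∀ᶠ t : ℝ in nhds 0, z - t • v ∈ titsConeCoord ρ := by
    apply hc.continuousAt.eventually_mem
    simp only [zero_smul, sub_zero]
    exact mem_interior_iff_mem_nhds.1 hz
  obtain ⟨ε, hε, hb⟩ := Metric.eventually_nhds_iff.1 h0
  have h1 := hb (y := ε / 2) (by simp [abs_of_pos hε]; linarith)
  have h2 := hρ.tits_imag_nonneg h h1
  rw [sub_eq_add_neg, evalR_add_left, evalR_neg_left, evalR_smul_left] at h2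
  have h3 : 0 < evalR v v := by
    unfold evalR
    obtain ⟨i, hi⟩ := Function.ne_iff.1 hv
    refine Finset.sum_pos' (fun i _ => mul_self_nonneg _) ⟨i, Finset.mem_univ _, ?_⟩
    exact mul_self_pos.2 hi
  nlinarith [mul_pos (half_pos hε) h3]

lemma IsTits.bounded_finite (hρ : IsTits cs ρ) (R : ℝ) :
    {β ∈ posRootSet ρ | ‖β‖ ≤ R}.Finite := by
  by_contra hinf
  have hinf : {β ∈ posRootSet ρ | ‖β‖ ≤ R}.Infinite := hinf
  obtain ⟨b, -, hb⟩ := hinf.exists_accPt_of_subset_isCompact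
    (isCompact_closedBall (0 : B → ℝ) R) (fun β hβ => by simpa using hβ.2)
  set S := {β ∈ posRootSet ρ | ‖β‖ ≤ R} with hS
  have hbb : coxForm M b b = 2 := by
    have hcl : IsClosed {x : B → ℝ | coxForm M x x = 2} :=
      isClosed_eq (continuous_id.coxForm' continuous_id) continuous_const
    have : b ∈ closure S := mem_closure_iff_clusterPt.2 hb.clusterPt
    exact closure_minimal (fun x hx => hρ.root_form hx.1.1) hcl this
  let F : B → (B → ℝ) × (B → ℝ) → ℝ := fun u p =>
    ((simpleRoot u - coxForm M p.2 (simpleRoot u) • p.2) -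
      coxForm M p.1 (simpleRoot u - coxForm M p.2 (simpleRoot u) • p.2) • p.1) u
  have hF : ∀ u, Continuous (F u) := by
    intro u
    have h1 : Continuous fun p : (B → ℝ) × (B → ℝ) =>
        (simpleRoot u - coxForm M p.2 (simpleRoot u) • p.2 : B → ℝ) :=
      continuous_const.sub ((continuous_snd.coxForm' continuous_const).smul continuous_snd)
    exact (continuous_apply u).comp (h1.sub ((continuous_fst.coxForm' h1).smul continuous_fst))
  have hFb : ∀ u, F u (b, b) = 1 := by
    intro u
    simp only [F, coxForm_sub_right, coxForm_smul_right, hbb]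
    simp [simpleRoot]; ring
  have hev : ∀ᶠ p in nhds (b, b), ∀ u, 0 < F u p := by
    rw [Filter.eventually_all]
    intro u
    exact (hF u).continuousAt.eventually_const_lt (by rw [hFb]; norm_num)
  rw [nhds_prod_eq] at hev
  obtain ⟨N, hN, hNF⟩ :=
    (Filter.eventually_prod_self_iff (r := fun x y => ∀ u, 0 < F u (x, y))).1 hev
  have hsub : ∀ β ∈ S, ∀ β' ∈ S, β ∈ N → β' ∈ N → β = β' := by
    intro β hβ β' hβ' h1 h2
    obtain ⟨w, hw⟩ := hρ.refl hβ.1.1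
    obtain ⟨w', hw'⟩ := hρ.refl hβ'.1.1
    have h3 : w * w' = 1 := by
      apply hρ.eq_one
      intro u
      rw [rho_mul_apply, hw, hw']
      exact hNF β h1 β' h2 u
    have h4 : ρ w (ρ w' β') = β' := by rw [← rho_mul_apply, h3]; simp
    rw [hw', hw, hρ.root_form hβ'.1.1] at h4
    refine (hρ.proportional hβ'.1 hβ.1 (c := coxForm M β β' / 2) ?_).symm
    have e : β' - (2:ℝ) • β' = - β' := by module
    rw [e, coxForm_symm, coxForm_neg_left, coxForm_symm] at h4
    have h5 : (2:ℝ) • β' = coxForm M β β' • β := by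
      have : (2:ℝ) • β' = β' + β' := two_smul _ _
      rw [this]
      nth_rw 1 [← h4]
      module
    rw [div_eq_inv_mul, mul_smul, ← h5, smul_smul]; norm_num
  rw [accPt_iff_nhds] at hb
  obtain ⟨x, ⟨hxN, hxS⟩, hxb⟩ := hb N hN
  have hN2 : N ∩ {x}ᶜ ∈ nhds b := Filter.inter_mem hN (isOpen_compl_singleton.mem_nhds hxb.symm)
  obtain ⟨y, ⟨⟨hyN, hyx⟩, hyS⟩, -⟩ := hb _ hN2
  exact hyx (hsub y hyS x hxS hyN hxN)

/-- `J` is orthogonal to its complement. -/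
def Isolated (M : CoxeterMatrix B) (J : Finset B) : Prop :=
  ∀ s ∈ J, ∀ t, t ∉ J → coxEntry M s t = 0

/-- `v` is supported in `J`. -/
def SuppIn (J : Finset B) (v : B → ℝ) : Prop := ∀ s, s ∉ J → v s = 0

lemma Isolated.form_zero {J : Finset B} (hJ : Isolated M J) {v : B → ℝ} (hv : SuppIn J v)
    {s : B} (hs : s ∉ J) : coxForm M v (simpleRoot s) = 0 := by
  rw [coxForm_simple_right]
  refine Finset.sum_eq_zero fun t _ => ?_
  by_cases ht : t ∈ J
  · rw [hJ t ht s hs, mul_zero]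
  · rw [hv t ht, zero_mul]

lemma Isolated.compl {J : Finset B} (hJ : Isolated M J) : Isolated M Jᶜ := by
  intro s hs t ht
  rw [coxEntry_symm]
  exact hJ t (by simpa using ht) s (by simpa using hs)

lemma IsTits.supp_simple (hρ : IsTits cs ρ) {J : Finset B} (hJ : Isolated M J) {v : B → ℝ}
    (hv : SuppIn J v) (s : B) : SuppIn J (ρ (cs.simple s) v) := by
  rw [hρ]
  by_cases hs : s ∈ J
  · intro t ht
    have : t ≠ s := by rintro rfl; exact ht hs
    simp [hv t ht, simpleRoot, this]
  · rw [coxForm_symm, hJ.form_zero hv hs]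
    simpa using hv

lemma IsTits.root_supp (hρ : IsTits cs ρ) {J : Finset B} (hJ : Isolated M J) {β : B → ℝ}
    (hβ : β ∈ rootSet ρ) : SuppIn J β ∨ SuppIn Jᶜ β := by
  obtain ⟨w, s, rfl⟩ := hβ
  induction w using cs.simple_induction_left with
  | one =>
    by_cases hs : s ∈ J
    · left
      intro t ht
      have : t ≠ s := by rintro rfl; exact ht hs
      simp [simpleRoot, this]
    · right
      intro t ht
      have : t ≠ s := by rintro rfl; exact ht (by simpa using hs)
      simp [simpleRoot, this]
  | mul_simple_left w t ih =>
    rw [rho_mul_apply]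
    exact ih.imp (fun h => hρ.supp_simple hJ h t) (fun h => hρ.supp_simple hJ.compl h t)

lemma SuppIn.add_smul {J : Finset B} {v w : B → ℝ} (hv : SuppIn J v) (hw : SuppIn J w) (c : ℝ) :
    SuppIn J (v + c • w) := by
  intro s hs
  simp [hv s hs, hw s hs]

lemma evalR_symm (v w : B → ℝ) : evalR v w = evalR w v := by
  unfold evalR
  exact Finset.sum_congr rfl fun i _ => by ring

lemma evalR_self_pos {v : B → ℝ} (hv : v ≠ 0) : 0 < evalR v v := by
  unfold evalR
  obtain ⟨i, hi⟩ := Function.ne_iff.1 hv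
  refine Finset.sum_pos' (fun i _ => mul_self_nonneg _) ⟨i, Finset.mem_univ _, ?_⟩
  exact mul_self_pos.2 hi

lemma linear_zero {b c : ℝ} (h : ∀ t : ℝ, 0 ≤ 2 * t * b + t ^ 2 * c) : b = 0 := by
  by_contra hb
  have hd : 0 < |c| + 1 := by positivity
  have h1 := h (-b / (|c| + 1))
  have h2 : c ≤ |c| := le_abs_self c
  have h3 : 2 * (-b / (|c| + 1)) * b + (-b / (|c| + 1)) ^ 2 * c
      = b ^ 2 * (c - 2 * (|c| + 1)) / (|c| + 1) ^ 2 := by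
    field_simp
    ring
  rw [h3] at h1
  have h4 : b ^ 2 * (c - 2 * (|c| + 1)) / (|c| + 1) ^ 2 < 0 := by
    apply div_neg_of_neg_of_pos _ (by positivity)
    apply mul_neg_of_pos_of_neg (by positivity)
    linarith [abs_nonneg c]
  linarith

lemma psd_zero {J : Finset B} {c : ℝ}
    (h : ∀ x : B → ℝ, SuppIn J x → c * evalR x x ≤ coxForm M x x) {z : B → ℝ} (hz : SuppIn J z)
    (he : coxForm M z z = c * evalR z z) {x : B → ℝ} (hx : SuppIn J x) :
    coxForm M z x = c * evalR z x := by
  have : coxForm M z x - c * evalR z x = 0 := by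
    apply linear_zero (c := coxForm M x x - c * evalR x x)
    intro t
    have h1 := h _ (hz.add_smul hx t)
    simp only [coxForm_add_left, coxForm_add_right, coxForm_smul_left, coxForm_smul_right,
      evalR_add, evalR_add_left, evalR_smul, evalR_smul_left] at h1
    rw [coxForm_symm x z, evalR_symm x z] at h1
    nlinarith
  linarith

lemma coxForm_abs_le (u : B → ℝ) : coxForm M |u| |u| ≤ coxForm M u u := by
  unfold coxForm
  refine Finset.sum_le_sum fun s _ => Finset.sum_le_sum fun t _ => ?_
  simp only [Pi.abs_apply]
  by_cases h : s = t
  · subst h; rw [abs_mul_abs_self]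
  · rw [← abs_mul]
    exact mul_le_mul_of_nonpos_right (le_abs_self _) (coxEntry_nonpos M h)

/-- A weak Perron-Frobenius statement. -/
lemma perron (M : CoxeterMatrix B) {J : Finset B} {v : B → ℝ} (hv : SuppIn J v) (hv0 : v ≠ 0) :
    ∃ (c : ℝ) (z : B → ℝ), SuppIn J z ∧ 0 ≤ z ∧ z ≠ 0 ∧
      (∀ x : B → ℝ, SuppIn J x → c * evalR x x ≤ coxForm M x x) ∧
      ∀ x : B → ℝ, SuppIn J x → coxForm M z x = c * evalR z x := by
  let E : Set (B → ℝ) := {u | SuppIn J u ∧ evalR u u = 1}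
  have hev : Continuous fun u : B → ℝ => evalR u u :=
    continuous_evalR.comp (continuous_id.prodMk continuous_id)
  have hEcl : IsClosed E := by
    apply IsClosed.inter
    · have : {u : B → ℝ | SuppIn J u} = ⋂ s, ⋂ (_ : s ∉ J), {u : B → ℝ | u s = 0} := by
        ext u; simp [SuppIn]
      change IsClosed {u : B → ℝ | SuppIn J u}
      rw [this]
      exact isClosed_iInter fun s => isClosed_iInter fun _ =>
        isClosed_eq (continuous_apply s) continuous_const
    · exact isClosed_eq hev continuous_const
  have hEc : IsCompact E := by
    apply (isCompact_closedBall (0 : B → ℝ) 1).of_isClosed_subset hEcl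
    rintro u ⟨-, hu⟩
    rw [mem_closedBall_zero_iff, pi_norm_le_iff_of_nonneg zero_le_one]
    intro i
    have h1 : u i * u i ≤ 1 := by
      rw [← hu]
      exact Finset.single_le_sum (f := fun i => u i * u i) (fun j _ => mul_self_nonneg _)
        (Finset.mem_univ i)
    rw [Real.norm_eq_abs]
    exact abs_le_one_iff_mul_self_le_one.2 h1
  have hscale : ∀ x : B → ℝ, SuppIn J x → x ≠ 0 → (Real.sqrt (evalR x x))⁻¹ • x ∈ E := by
    intro x hx hx0
    have hp := evalR_self_pos hx0
    refine ⟨fun s hs => by simp [hx s hs], ?_⟩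
    rw [evalR_smul, evalR_smul_left, ← mul_assoc, ← mul_inv, Real.mul_self_sqrt hp.le]
    exact inv_mul_cancel₀ hp.ne'
  obtain ⟨u, huE, hmin⟩ := hEc.exists_isMinOn ⟨_, hscale v hv hv0⟩
    ((continuous_id.coxForm' (M := M) continuous_id).continuousOn)
  have hall : ∀ x : B → ℝ, SuppIn J x → coxForm M u u * evalR x x ≤ coxForm M x x := by
    intro x hx
    by_cases hx0 : x = 0
    · subst hx0; simp [evalR, coxForm]
    have h1 := hmin (hscale x hx hx0)
    have hp := evalR_self_pos hx0
    simp only [Set.mem_ofPred_eq, id] at h1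
    rw [coxForm_smul_left, coxForm_smul_right, ← mul_assoc, ← mul_inv,
      Real.mul_self_sqrt hp.le, ← div_eq_inv_mul, le_div_iff₀ hp] at h1
    exact h1
  have habs : SuppIn J |u| := fun s hs => by simp [huE.1 s hs]
  have hn : evalR |u| |u| = 1 := by
    rw [← huE.2]; unfold evalR
    exact Finset.sum_congr rfl fun i _ => by simp
  refine ⟨coxForm M u u, |u|, habs, abs_nonneg u, ?_, hall, fun x hx => ?_⟩
  · intro h; rw [h] at hn; simp [evalR] at hn
  · refine psd_zero hall habs (le_antisymm ?_ (hall _ habs)) hx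
    rw [hn, mul_one]
    exact coxForm_abs_le u

open Filter Topology in
lemma IsTits.limit (hρ : IsTits cs ρ) {z : B → ℝ}
    (hinf : {β ∈ posRootSet ρ | evalR z β ≤ 0}.Infinite) :
    ∃ v ∈ imagCone M ρ, v ≠ 0 ∧ evalR z v ≤ 0 := by
  let S : Finset B → Set (B → ℝ) := fun J => {β ∈ posRootSet ρ | evalR z β ≤ 0 ∧ SuppIn J β}
  let 𝒥 : Set (Finset B) := {J | Isolated M J ∧ (S J).Infinite}
  have hne : 𝒥.Nonempty := by
    refine ⟨Finset.univ, fun s _ t ht => absurd (Finset.mem_univ t) ht, ?_⟩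
    refine hinf.mono ?_
    rintro β ⟨h1, h2⟩
    exact ⟨h1, h2, fun s hs => absurd (Finset.mem_univ s) hs⟩
  obtain ⟨J, ⟨hJ, hSJ⟩, hJmin⟩ := wellFounded_lt.has_min 𝒥 hne
  -- an unbounded sequence of roots
  have hseq : ∀ n : ℕ, ∃ β ∈ S J, (n : ℝ) < ‖β‖ := by
    intro n
    by_contra! hc
    exact hSJ ((hρ.bounded_finite n).subset fun β hβ => ⟨hβ.1, hc β hβ⟩)
  choose β hβ hβn using hseq
  have hβpos : ∀ n, 0 < ‖β n‖ := fun n => lt_of_le_of_lt (Nat.cast_nonneg n) (hβn n)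
  set c : ℕ → ℝ := fun n => ‖β n‖⁻¹ with hc
  have hcpos : ∀ n, 0 < c n := fun n => inv_pos.2 (hβpos n)
  have hc0 : Tendsto c atTop (𝓝 0) :=
    tendsto_inv_atTop_zero.comp
      (tendsto_atTop_mono (fun n => (hβn n).le) tendsto_natCast_atTop_atTop)
  set x : ℕ → (B → ℝ) := fun n => c n • β n with hx
  obtain ⟨v, hv1, φ, hφ, hlim⟩ := (isCompact_sphere (0 : B → ℝ) 1).tendsto_subseq (x := x)
    (fun n => by
      rw [mem_sphere_zero_iff_norm]
      simp only [hx, hc, norm_smul, norm_inv, norm_norm]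
      exact inv_mul_cancel₀ (hβpos n).ne')
  have hcφ : Tendsto (c ∘ φ) atTop (𝓝 0) := hc0.comp hφ.tendsto_atTop
  have hv0 : v ≠ 0 := by
    rintro rfl; simp at hv1
  have happ : ∀ s, Tendsto (fun n => x (φ n) s) atTop (𝓝 (v s)) := fun s =>
    ((continuous_apply s).tendsto v).comp hlim
  have hvpos : 0 ≤ v := by
    intro s
    refine ge_of_tendsto' (happ s) fun n => ?_
    exact mul_nonneg (hcpos _).le ((hβ (φ n)).1.2 s)
  have hvJ : SuppIn J v := by
    intro s hs
    refine tendsto_nhds_unique (happ s) ?_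
    have : (fun n => x (φ n) s) = fun _ => 0 := by
      ext n
      simp [hx, (hβ (φ n)).2.2 s hs]
    rw [this]; exact tendsto_const_nhds
  have hzv : evalR z v ≤ 0 := by
    have h1 : Tendsto (fun n => evalR z (x (φ n))) atTop (𝓝 (evalR z v)) :=
      ((continuous_evalR.comp (continuous_const.prodMk continuous_id)).tendsto v).comp hlim
    refine le_of_tendsto' h1 fun n => ?_
    simp only [hx, evalR_smul]
    exact mul_nonpos_of_nonneg_of_nonpos (hcpos _).le (hβ (φ n)).2.1
  obtain ⟨l, y, hyJ, hy0, hyne, hpsd, hy⟩ := perron M hvJ hv0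
  by_cases hl : 0 ≤ l
  · -- semidefinite case
    refine ⟨v, ?_, hv0, hzv⟩
    have hq : coxForm M v v = 0 := by
      have h1 : Tendsto (fun n => coxForm M (x (φ n)) (x (φ n))) atTop (𝓝 (coxForm M v v)) :=
        ((continuous_id.coxForm' (M := M) continuous_id).tendsto v).comp hlim
      have h2 : Tendsto (fun n => (c ∘ φ) n * ((c ∘ φ) n * 2)) atTop (𝓝 (0 * (0 * 2))) :=
        hcφ.mul (hcφ.mul_const 2)
      have h3 : (fun n => coxForm M (x (φ n)) (x (φ n))) =
          fun n => (c ∘ φ) n * ((c ∘ φ) n * 2) := by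
        ext n
        simp only [hx, coxForm_smul_left, coxForm_smul_right, hρ.root_form (hβ (φ n)).1.1,
          Function.comp]
      rw [h3] at h1
      rw [tendsto_nhds_unique h1 h2]; ring
    have hpsd0 : ∀ x : B → ℝ, SuppIn J x → 0 * evalR x x ≤ coxForm M x x := by
      intro x hx
      rw [zero_mul]
      refine le_trans ?_ (hpsd x hx)
      exact mul_nonneg hl (Finset.sum_nonneg fun i _ => mul_self_nonneg _)
    rw [imagCone_eq]
    apply subset_closure
    refine ⟨1, v, ⟨hvpos, fun s => ?_⟩, by simp⟩
    by_cases hs : s ∈ J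
    · rw [psd_zero hpsd0 hvJ (by rw [hq, zero_mul]), zero_mul]
      intro t ht
      have : t ≠ s := by rintro rfl; exact ht hs
      simp [simpleRoot, this]
    · rw [hJ.form_zero hvJ hs]
  · -- indefinite case
    push Not at hl
    have hys : ∀ s ∈ J, coxForm M y (simpleRoot s) = l * y s := by
      intro s hs
      rw [hy, evalR_simpleRoot]
      intro t ht
      have : t ≠ s := by rintro rfl; exact ht hs
      simp [simpleRoot, this]
    have hyK : y ∈ coneK M := by
      refine ⟨hy0, fun s => ?_⟩
      by_cases hs : s ∈ J
      · rw [hys s hs]; exact mul_nonpos_of_nonpos_of_nonneg hl.le (hy0 s)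
      · rw [hJ.form_zero hyJ hs]
    let J₁ : Finset B := J.filter fun s => 0 < y s
    have hJ₁ : Isolated M J₁ := by
      intro s hs t ht
      rw [Finset.mem_filter] at hs ht
      by_cases htJ : t ∈ J
      · have hyt : y t = 0 := by
          by_contra h
          exact ht ⟨htJ, lt_of_le_of_ne (hy0 t) (Ne.symm h)⟩
        have h1 := hys t htJ
        rw [hyt, mul_zero, coxForm_simple_right] at h1
        rw [Finset.sum_eq_zero_iff_of_nonpos] at h1
        · have h2 := h1 s (Finset.mem_univ s)
          exact (mul_eq_zero.1 h2).resolve_left hs.2.ne'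
        · intro r _
          by_cases hr : r = t
          · rw [hr, hyt, zero_mul]
          · exact mul_nonpos_of_nonneg_of_nonpos (hy0 r) (coxEntry_nonpos M hr)
      · exact hJ s hs.1 t htJ
    have hJ₂ : Isolated M (J \ J₁) := by
      intro s hs t ht
      rw [Finset.mem_sdiff] at hs ht
      by_cases htJ : t ∈ J
      · rw [coxEntry_symm]
        exact hJ₁ t (by by_contra h; exact ht ⟨htJ, h⟩) s hs.2
      · exact hJ s hs.1 t htJ
    have hcover : S J ⊆ S J₁ ∪ S (J \ J₁) := by
      rintro b ⟨h1, h2, h3⟩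
      rcases hρ.root_supp hJ₁ h1.1 with h | h
      · exact .inl ⟨h1, h2, h⟩
      · refine .inr ⟨h1, h2, fun s hs => ?_⟩
        by_cases hsJ : s ∈ J
        · refine h s ?_
          rw [Finset.mem_compl, not_not]
          by_contra hc
          exact hs (Finset.mem_sdiff.2 ⟨hsJ, hc⟩)
        · exact h3 s hsJ
    have hJeq : J₁ = J := by
      rcases Set.infinite_union.1 (hSJ.mono hcover) with h | h
      · by_contra hne
        exact hJmin J₁ ⟨hJ₁, h⟩
          (lt_of_le_of_ne (Finset.filter_subset _ _) hne)
      · exfalso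
        have h1 : J \ J₁ = J := by
          by_contra hne
          exact hJmin _ ⟨hJ₂, h⟩ (lt_of_le_of_ne Finset.sdiff_subset hne)
        apply hyne
        ext s
        by_cases hs : s ∈ J
        · rw [← h1, Finset.mem_sdiff, Finset.mem_filter] at hs
          by_contra h
          exact hs.2 ⟨hs.1, lt_of_le_of_ne (hy0 s) (Ne.symm h)⟩
        · exact hyJ s hs
    have hev : 0 < evalR y v := by
      obtain ⟨s, hs⟩ := Function.ne_iff.1 hv0
      have hsJ : s ∈ J := by
        by_contra h
        exact hs (hvJ s h)
      have hys' : 0 < y s := by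
        rw [← hJeq, Finset.mem_filter] at hsJ
        exact hsJ.2
      refine Finset.sum_pos' (fun i _ => mul_nonneg (hvpos i) (hy0 i)) ⟨s, Finset.mem_univ s, ?_⟩
      exact mul_pos (lt_of_le_of_ne (hvpos s) (Ne.symm hs)) hys'
    set d : ℝ := - coxForm M v y with hd
    have hdpos : 0 < d := by
      rw [hd, coxForm_symm, hy v hvJ]
      nlinarith
    refine ⟨d • v, ?_, smul_ne_zero hdpos.ne' hv0, ?_⟩
    · have h1 : Tendsto (fun n => (c ∘ φ) n • (c ∘ φ) n • y +
          (- coxForm M ((x ∘ φ) n) y) • (x ∘ φ) n) atTop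
          (𝓝 ((0 : ℝ) • (0 : ℝ) • y + d • v)) := by
        refine (hcφ.smul (hcφ.smul_const y)).add (Tendsto.smul (Tendsto.neg ?_) hlim)
        exact ((continuous_id.coxForm' (M := M) continuous_const).tendsto v).comp hlim
      rw [zero_smul, zero_add] at h1
      rw [imagCone_eq]
      refine mem_closure_of_tendsto h1 (Eventually.of_forall fun n => ?_)
      obtain ⟨w, hw⟩ := hρ.refl (hβ (φ n)).1.1
      have h2 : ρ w y ∈ imag0 M ρ := ⟨w, y, hyK, rfl⟩
      have h3 := imag0_smul (imag0_smul h2 (hcpos (φ n)).le) (hcpos (φ n)).le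
      rw [hw] at h3
      convert h3 using 1
      simp only [hx, Function.comp, coxForm_smul_left]
      module
    · rw [evalR_smul]
      exact mul_nonpos_of_nonneg_of_nonpos hdpos.le hzv

lemma IsTits.pos_infinite (hρ : IsTits cs ρ) (hW : Infinite W) : (posRootSet ρ).Infinite := by
  intro hfin
  have hroot : (rootSet ρ).Finite := by
    refine (hfin.union (hfin.image fun v => -v)).subset ?_
    intro β hβ
    rcases hρ.root_pos_or_neg hβ with h | h
    · exact .inl ⟨hβ, h⟩
    · refine .inr ⟨-β, ⟨?_, ?_⟩, by simp⟩
      · obtain ⟨w, s, rfl⟩ := hβ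
        exact ⟨w * cs.simple s, s, by rw [rho_mul_apply, hρ.simple_self, map_neg]⟩
      · intro i
        have := h i
        simpa using this
  have : Finite (rootSet ρ) := hroot
  have hinj : Function.Injective
      (fun (w : W) (s : B) => (⟨ρ w (simpleRoot s), w, s, rfl⟩ : rootSet ρ)) := by
    intro w w' h
    have h1 : w'⁻¹ * w = 1 := by
      apply hρ.eq_one
      intro s
      have h2 := congrArg Subtype.val (congrFun h s)
      simp only at h2
      rw [rho_mul_apply, h2, rho_inv_apply]
      simp [simpleRoot]
    exact (inv_mul_eq_one.1 h1).symm
  exact not_finite_iff_infinite.2 hW (Finite.of_injective _ hinj)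

lemma IsTits.exists_imag (hρ : IsTits cs ρ) (hW : Infinite W) :
    ∃ v ∈ imagCone M ρ, v ≠ 0 := by
  obtain ⟨v, hv, h0, -⟩ := hρ.limit (z := 0) ((hρ.pos_infinite hW).mono fun β hβ =>
    ⟨hβ, by simp [evalR]⟩)
  exact ⟨v, hv, h0⟩

lemma IsTits.mem_of_pos (hρ : IsTits cs ρ) {z : B → ℝ}
    (h : ∀ v ∈ imagCone M ρ, v ≠ 0 → 0 < evalR z v) : z ∈ titsConeCoord ρ := by
  rw [hρ.mem_iff]
  by_contra hinf
  obtain ⟨v, hv, h0, hz⟩ := hρ.limit (z := z)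
    (Set.Infinite.mono (fun β hβ => ⟨hβ.1, le_of_lt hβ.2⟩) hinf)
  linarith [h v hv h0]

open Filter Topology in
lemma IsTits.mem_interior_of_pos (hρ : IsTits cs ρ) {z : B → ℝ}
    (h : ∀ v ∈ imagCone M ρ, v ≠ 0 → 0 < evalR z v) : z ∈ interior (titsConeCoord ρ) := by
  rw [mem_interior_iff_mem_nhds]
  have hK : IsCompact (imagCone M ρ ∩ Metric.sphere 0 1) :=
    (isCompact_sphere (0 : B → ℝ) 1).inter_left isClosed_closure
  have hev : ∀ᶠ z' in 𝓝 z, ∀ v ∈ imagCone M ρ ∩ Metric.sphere 0 1, 0 < evalR z' v := by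
    apply hK.eventually_forall_of_forall_eventually
    rintro v ⟨hv, hv1⟩
    have hv0 : v ≠ 0 := by rintro rfl; simp at hv1
    exact (continuous_evalR (B := B)).continuousAt.eventually_const_lt (h v hv hv0)
  filter_upwards [hev] with z' hz'
  apply hρ.mem_of_pos
  intro v hv hv0
  have hn : 0 < ‖v‖ := norm_pos_iff.2 hv0
  have h1 := hz' (‖v‖⁻¹ • v) ⟨imagCone_smul hv (inv_pos.2 hn).le, by
    rw [mem_sphere_zero_iff_norm, norm_smul, norm_inv, norm_norm]
    exact inv_mul_cancel₀ hn.ne'⟩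
  rw [evalR_smul] at h1
  exact (mul_pos_iff_of_pos_left (inv_pos.2 hn)).1 h1

lemma IsTits.mem_interior_of_ne (hρ : IsTits cs ρ) {z : B → ℝ}
    (h : ∀ v ∈ imagCone M ρ, v ≠ 0 → evalR z v ≠ 0) {v₀ : B → ℝ} (hv₀ : v₀ ∈ imagCone M ρ)
    (hpos : 0 < evalR z v₀) : z ∈ interior (titsConeCoord ρ) := by
  apply hρ.mem_interior_of_pos
  intro v hv hv0
  by_contra hle
  have hlt : evalR z v < 0 := lt_of_le_of_ne (not_lt.1 hle) (h v hv hv0)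
  have hm := hρ.imagCone_add (imagCone_smul hv hpos.le)
    (imagCone_smul hv₀ (c := - evalR z v) (by linarith))
  refine h _ hm ?_ ?_
  · intro h0
    have a : 0 ≤ v := by simpa using hρ.imagCone_nonneg hv 1
    have b : 0 ≤ v₀ := by simpa using hρ.imagCone_nonneg hv₀ 1
    apply hv0
    ext i
    have e := congrFun h0 i
    simp only [Pi.add_apply, Pi.smul_apply, smul_eq_mul, Pi.zero_apply] at e
    have a' : 0 ≤ v i := a i
    have b' : 0 ≤ v₀ i := b i
    have h1 : 0 ≤ -evalR z v * v₀ i := mul_nonneg (by linarith) b'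
    have h2 : evalR z v₀ * v i = 0 := le_antisymm (by linarith) (mul_nonneg hpos.le a')
    simpa using (mul_eq_zero.1 h2).resolve_left hpos.ne'
  · rw [evalR_add, evalR_smul, evalR_smul]; ring

end CoxAux

/-!
STATEMENT 7: If the Coxeter group W is infinite, the dual space decomposes as the disjoint
union of the interior of the Tits cone, the set U of functionals vanishing on some nonzero
element of the closed imaginary cone, and the negative of the interior of the Tits cone.
-/
theorem dual_decomposition_of_infinite
    {B : Type*} [Fintype B] [DecidableEq B] (M : CoxeterMatrix B)
    {W : Type*} [Group W] (cs : CoxeterSystem M W)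
    (ρ : W →* ((B → ℝ) ≃ₗ[ℝ] (B → ℝ)))
    (hρ : ∀ (s : B) (v : B → ℝ),
      ρ (cs.simple s) v = v - coxForm M (simpleRoot s) v • simpleRoot s)
    (hW : Infinite W) :
    interior (titsConeCoord ρ) ∪ {z | ∃ v ∈ imagCone M ρ, v ≠ 0 ∧ evalR z v = 0} ∪
        {z | -z ∈ interior (titsConeCoord ρ)} = Set.univ ∧
      Disjoint (interior (titsConeCoord ρ))
        {z | ∃ v ∈ imagCone M ρ, v ≠ 0 ∧ evalR z v = 0} ∧
      Disjoint {z | ∃ v ∈ imagCone M ρ, v ≠ 0 ∧ evalR z v = 0}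
        {z | -z ∈ interior (titsConeCoord ρ)} ∧
      Disjoint (interior (titsConeCoord ρ))
        {z | -z ∈ interior (titsConeCoord ρ)} := by
  have hT : IsTits cs ρ := hρ
  obtain ⟨v₀, hv₀, hne⟩ := hT.exists_imag hW
  refine ⟨?_, ?_, ?_, ?_⟩
  · rw [Set.eq_univ_iff_forall]
    intro z
    by_cases hU : ∃ v ∈ imagCone M ρ, v ≠ 0 ∧ evalR z v = 0
    · exact .inl (.inr hU)
    · push Not at hU
      rcases lt_or_gt_of_ne (hU v₀ hv₀ hne) with h | h
      · refine .inr ?_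
        refine hT.mem_interior_of_ne (z := -z) (fun v hv h0 => ?_) hv₀ ?_
        · rw [evalR_neg_left]; exact neg_ne_zero.2 (hU v hv h0)
        · rw [evalR_neg_left]; linarith
      · exact .inl (.inl (hT.mem_interior_of_ne hU hv₀ h))
  · rw [Set.disjoint_left]
    rintro z hz ⟨v, hv, h0, he⟩
    linarith [hT.interior_imag_pos hv h0 hz]
  · rw [Set.disjoint_left]
    rintro z ⟨v, hv, h0, he⟩ hz
    have := hT.interior_imag_pos hv h0 hz
    rw [evalR_neg_left] at this
    linarith
  · rw [Set.disjoint_left]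
    intro z hz hz'
    have h1 := hT.interior_imag_pos hv₀ hne hz
    have h2 := hT.interior_imag_pos hv₀ hne hz'
    rw [evalR_neg_left] at h2
    linarith
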